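/- Let f ∈ H^{3/2}(ℝ/ℤ) be a closed curve in ℝⁿ whose unit tangent t = f'/‖f'‖ satisfies [t]_{H^{1/2}} < ∞, satisfying the bi-Lipschitz condition and, for each m, the equilateral condition, and assume lim_{ε→0⁺} ε⁻¹·K(f',ε)² = 0. Define I₁₂(i,j) = ½·(g_{ij,d}/g_{ij,n})·( (1 − A_{ij}‖Δ_{i+1}^{j+1}f‖ / A_{ij}‖Δᵢʲf‖)·(uᵢ·uⱼ) + (1 − A_{ij}‖Δᵢʲf‖ / A_{ij}‖Δ_{i+1}^{j+1}f‖)·(uᵢ₊₁·uⱼ₊₁) ), where uₖ = Δₖf/‖Δₖf‖, g_{ij,d} = ‖Δᵢf‖‖Δⱼf‖, g_{ij,n} = ‖Δᵢʲf‖‖Δ_{i+1}^{j+1}f‖. Then lim_{m→∞} Σ_{i≠j (mod m)} I₁₂(i,j) = 0. -/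

import Mathlib

open MeasureTheory Real
open scoped RealInnerProductSpace ENNReal

noncomputable section

/-- The standard distance on `ℝ/ℤ`, expressed through real representatives. -/
def circleDist (a b : ℝ) : ℝ := min (Int.fract (a - b)) (1 - Int.fract (a - b))

/-- The `H^{1/2}`-seminorm `[u]_{H^{1/2}(I×J)}`. -/
def seminormH {n : ℕ} (u : ℝ → EuclideanSpace ℝ (Fin n)) (I J : Set ℝ) : ℝ :=
  Real.sqrt (∫ a in I, ∫ b in J, ‖u a - u b‖ ^ 2 / circleDist a b ^ 2)

/-- `K(u, ε)`: supremum of the `H^{1/2}`-seminorms of `u` over pairs of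
measurable subsets of `ℝ/ℤ` of measure at most `ε`. -/
def Kmod {n : ℕ} (u : ℝ → EuclideanSpace ℝ (Fin n)) (ε : ℝ) : ℝ :=
  sSup { r : ℝ | ∃ I J : Set ℝ, MeasurableSet I ∧ MeasurableSet J ∧
    I ⊆ Set.Ico (0 : ℝ) 1 ∧ J ⊆ Set.Ico (0 : ℝ) 1 ∧
    volume I ≤ ENNReal.ofReal ε ∧ volume J ≤ ENNReal.ofReal ε ∧
    r = seminormH u I J }

/-- Difference operator `Δᵢ` in the first index. -/
def dOpI (u : ℤ → ℤ → ℝ) (i j : ℤ) : ℝ := u (i + 1) j - u i j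

/-- Difference operator `Δⱼ` in the second index. -/
def dOpJ (u : ℤ → ℤ → ℝ) (i j : ℤ) : ℝ := u i (j + 1) - u i j

/-- Arithmetic mean `Aᵢ` in the first index. -/
def aOpI (u : ℤ → ℤ → ℝ) (i j : ℤ) : ℝ := (u i j + u (i + 1) j) / 2

/-- Arithmetic mean `Aⱼ` in the second index. -/
def aOpJ (u : ℤ → ℤ → ℝ) (i j : ℤ) : ℝ := (u i j + u i (j + 1)) / 2

/-- Arithmetic mean `A_{ij}` over the four corners. -/
def aOpIJ (u : ℤ → ℤ → ℝ) (i j : ℤ) : ℝ :=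
  (u i j + u (i + 1) j + u i (j + 1) + u (i + 1) (j + 1)) / 4

/-- The chord `Δᵢʲf = f(θⱼ) − f(θᵢ)`. -/
def chord {n : ℕ} (f : ℝ → EuclideanSpace ℝ (Fin n)) (θ : ℤ → ℝ) (i j : ℤ) :
    EuclideanSpace ℝ (Fin n) := f (θ j) - f (θ i)

/-- The edge `Δᵢf = f(θᵢ₊₁) − f(θᵢ)`. -/
def edge {n : ℕ} (f : ℝ → EuclideanSpace ℝ (Fin n)) (θ : ℤ → ℝ) (i : ℤ) :
    EuclideanSpace ℝ (Fin n) := f (θ (i + 1)) - f (θ i)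

/-- The unit edge vector `Δᵢf/‖Δᵢf‖`. -/
def uedge {n : ℕ} (f : ℝ → EuclideanSpace ℝ (Fin n)) (θ : ℤ → ℝ) (i : ℤ) :
    EuclideanSpace ℝ (Fin n) := ‖edge f θ i‖⁻¹ • edge f θ i

/-- Chord length `‖Δᵢʲf‖` as a doubly indexed quantity. -/
def chn {n : ℕ} (f : ℝ → EuclideanSpace ℝ (Fin n)) (θ : ℤ → ℝ) (i j : ℤ) : ℝ :=
  ‖chord f θ i j‖


/-- Sum of `F i j` over ordered pairs of distinct residues mod `m`,
represented by indices in `{1, …, m}`. -/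
def discSum (m : ℕ) (F : ℤ → ℤ → ℝ) : ℝ :=
  ∑ i ∈ Finset.Icc (1 : ℤ) (m : ℤ), ∑ j ∈ Finset.Icc (1 : ℤ) (m : ℤ),
    if i = j then 0 else F i j

/-- The discrete cross ratio
`g_{ij} = ‖Δᵢʲf‖‖Δ_{i+1}^{j+1}f‖/(‖Δᵢf‖‖Δⱼf‖)`. -/
def crossRatio {n : ℕ} (f : ℝ → EuclideanSpace ℝ (Fin n)) (θ : ℤ → ℝ)
    (i j : ℤ) : ℝ :=
  (chn f θ i j * chn f θ (i + 1) (j + 1)) / (‖edge f θ i‖ * ‖edge f θ j‖)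

/-- The unit tangent vector `t = f'/‖f'‖`. -/
def tang {n : ℕ} (f : ℝ → EuclideanSpace ℝ (Fin n)) (x : ℝ) :
    EuclideanSpace ℝ (Fin n) := ‖deriv f x‖⁻¹ • deriv f x

theorem circleDist_eq_norm (a b : ℝ) : circleDist a b = ‖((a - b : ℝ) : UnitAddCircle)‖ := by
  rw [UnitAddCircle.norm_eq, abs_sub_round_eq_min, circleDist]

theorem circleDist_nonneg (a b : ℝ) : 0 ≤ circleDist a b := by
  rw [circleDist_eq_norm]
  exact norm_nonneg _

theorem circleDist_comm (a b : ℝ) : circleDist a b = circleDist b a := by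
  rw [circleDist_eq_norm, circleDist_eq_norm, ← norm_neg, ← QuotientAddGroup.mk_neg, neg_sub]

theorem circleDist_triangle (a b c : ℝ) : circleDist a c ≤ circleDist a b + circleDist b c := by
  simp only [circleDist_eq_norm]
  have h : (a - c : ℝ) = (a - b) + (b - c) := by ring
  rw [h, QuotientAddGroup.mk_add]
  exact norm_add_le _ _

theorem circleDist_le_abs (a b : ℝ) : circleDist a b ≤ |a - b| := by
  rw [circleDist_eq_norm, UnitAddCircle.norm_eq]
  simpa using round_le (a - b) 0

theorem circleDist_eq_min {a b : ℝ} (h₀ : 0 < b - a) (h₁ : b - a < 1) :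
    circleDist a b = min (b - a) (1 - (b - a)) := by
  rw [circleDist_comm, circleDist, Int.fract_eq_self.mpr ⟨h₀.le, h₁⟩]

theorem circleDist_add_one_left (a b : ℝ) : circleDist (a + 1) b = circleDist a b := by
  rw [circleDist, circleDist, add_sub_right_comm, Int.fract_add_one]

theorem circleDist_add_one_right (a b : ℝ) : circleDist a (b + 1) = circleDist a b := by
  rw [circleDist_comm, circleDist_add_one_left, circleDist_comm]

theorem continuous_circleDist : Continuous fun p : ℝ × ℝ => circleDist p.1 p.2 := by
  simp only [circleDist_eq_norm]
  exact ((AddCircle.continuous_mk' 1).comp (continuous_fst.sub continuous_snd)).norm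

theorem exists_int_eq_add_of_circleDist_eq_zero {a b : ℝ} (h : circleDist a b = 0) :
    ∃ k : ℤ, a = b + k := by
  refine ⟨round (a - b), ?_⟩
  rw [circleDist_eq_norm, UnitAddCircle.norm_eq, abs_eq_zero] at h
  linarith

theorem apply_add_int_of_periodic {E : Type*} {u : ℝ → E} (hu : ∀ x, u (x + 1) = u x)
    (x : ℝ) (k : ℤ) : u (x + k) = u x := by
  have h : Function.Periodic u 1 := hu
  simpa using h.int_mul k x

theorem measurePreserving_coe_equivIoc (a : ℝ) :
    MeasurePreserving (fun x : UnitAddCircle => (AddCircle.equivIoc 1 a x : ℝ)) volume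
      (volume.restrict (Set.Ioc a (a + 1))) :=
  (measurePreserving_subtype_coe measurableSet_Ioc).comp
    (AddCircle.measurePreserving_equivIoc 1)

theorem measurableEmbedding_coe_equivIoc (a : ℝ) :
    MeasurableEmbedding (fun x : UnitAddCircle => (AddCircle.equivIoc 1 a x : ℝ)) :=
  (MeasurableEmbedding.subtype_coe measurableSet_Ioc).comp
    (AddCircle.measurableEquivIoc 1 a).measurableEmbedding

theorem exists_equivIoc_eq_add (a b : ℝ) (x : UnitAddCircle) :
    ∃ k : ℤ, (AddCircle.equivIoc 1 a x : ℝ) = AddCircle.equivIoc 1 b x + k := by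
  have h : ((AddCircle.equivIoc 1 a x : ℝ) : UnitAddCircle) =
      ((AddCircle.equivIoc 1 b x : ℝ) : UnitAddCircle) := by
    rw [AddCircle.coe_equivIoc, AddCircle.coe_equivIoc]
  rw [← sub_eq_zero, ← QuotientAddGroup.mk_sub] at h
  obtain ⟨k, hk⟩ := (AddCircle.coe_eq_zero_iff 1).mp h
  exact ⟨k, by simp at hk; linarith⟩

section DoublyPeriodic

variable {H : ℝ × ℝ → ℝ}

theorem measurePreserving_prod_equivIoc (a b : ℝ) :
    MeasurePreserving (Prod.map (fun x : UnitAddCircle => (AddCircle.equivIoc 1 a x : ℝ))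
      (fun x : UnitAddCircle => (AddCircle.equivIoc 1 b x : ℝ))) volume
      (volume.restrict (Set.Ioc a (a + 1) ×ˢ Set.Ioc b (b + 1))) := by
  have h := (measurePreserving_coe_equivIoc a).prod (measurePreserving_coe_equivIoc b)
  rwa [Measure.prod_restrict] at h

theorem measurableEmbedding_prod_equivIoc (a b : ℝ) :
    MeasurableEmbedding (Prod.map (fun x : UnitAddCircle => (AddCircle.equivIoc 1 a x : ℝ))
      (fun x : UnitAddCircle => (AddCircle.equivIoc 1 b x : ℝ))) :=
  (measurableEmbedding_coe_equivIoc a).prodMap (measurableEmbedding_coe_equivIoc b)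

theorem comp_prod_equivIoc_eq (h₁ : ∀ x y, H (x + 1, y) = H (x, y))
    (h₂ : ∀ x y, H (x, y + 1) = H (x, y)) (a b c d : ℝ) :
    H ∘ Prod.map (fun x : UnitAddCircle => (AddCircle.equivIoc 1 a x : ℝ))
      (fun x : UnitAddCircle => (AddCircle.equivIoc 1 b x : ℝ)) =
    H ∘ Prod.map (fun x : UnitAddCircle => (AddCircle.equivIoc 1 c x : ℝ))
      (fun x : UnitAddCircle => (AddCircle.equivIoc 1 d x : ℝ)) := by
  funext ⟨x, y⟩
  obtain ⟨k, hk⟩ := exists_equivIoc_eq_add a c x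
  obtain ⟨l, hl⟩ := exists_equivIoc_eq_add b d y
  simp only [Function.comp_apply, Prod.map_apply, hk, hl]
  rw [apply_add_int_of_periodic (u := fun s => H (s, _)) (fun s => h₁ s _),
    apply_add_int_of_periodic (u := fun s => H (_, s)) (fun s => h₂ _ s)]

theorem integrableOn_Ioc_prod_iff (h₁ : ∀ x y, H (x + 1, y) = H (x, y))
    (h₂ : ∀ x y, H (x, y + 1) = H (x, y)) (a b c d : ℝ) :
    IntegrableOn H (Set.Ioc a (a + 1) ×ˢ Set.Ioc b (b + 1)) volume ↔
      IntegrableOn H (Set.Ioc c (c + 1) ×ˢ Set.Ioc d (d + 1)) volume := by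
  rw [IntegrableOn, IntegrableOn, ← (measurePreserving_prod_equivIoc a b).integrable_comp_emb
    (measurableEmbedding_prod_equivIoc a b),
    ← (measurePreserving_prod_equivIoc c d).integrable_comp_emb
    (measurableEmbedding_prod_equivIoc c d), comp_prod_equivIoc_eq h₁ h₂ a b c d]

theorem setIntegral_Ioc_prod_eq (h₁ : ∀ x y, H (x + 1, y) = H (x, y))
    (h₂ : ∀ x y, H (x, y + 1) = H (x, y)) (a b c d : ℝ) :
    ∫ p in Set.Ioc a (a + 1) ×ˢ Set.Ioc b (b + 1), H p =
      ∫ p in Set.Ioc c (c + 1) ×ˢ Set.Ioc d (d + 1), H p := by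
  rw [← (measurePreserving_prod_equivIoc a b).integral_comp
    (measurableEmbedding_prod_equivIoc a b), ← (measurePreserving_prod_equivIoc c d).integral_comp
    (measurableEmbedding_prod_equivIoc c d)]
  exact congrArg (fun K => ∫ p, K p) (comp_prod_equivIoc_eq h₁ h₂ a b c d)

end DoublyPeriodic

theorem Ico_prod_ae_eq_Ioc_prod (a b c d : ℝ) :
    (Set.Ico a b ×ˢ Set.Ico c d : Set (ℝ × ℝ)) =ᵐ[volume] Set.Ioc a b ×ˢ Set.Ioc c d :=
  Measure.set_prod_ae_eq Ico_ae_eq_Ioc Ico_ae_eq_Ioc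

theorem tendsto_integral_weight_mul {G : ℝ × ℝ → ℝ} {S : Set (ℝ × ℝ)} (hG : IntegrableOn G S volume)
    (hG0 : ∀ p, circleDist p.1 p.2 = 0 → G p = 0) {ℓ : ℕ → ℝ} (hℓ0 : ∀ᶠ m in Filter.atTop, 0 < ℓ m)
    (hℓ : Filter.Tendsto ℓ Filter.atTop (nhds 0)) :
    Filter.Tendsto (fun m => ∫ p in S, ℓ m / (ℓ m + circleDist p.1 p.2) * G p)
      Filter.atTop (nhds 0) := by
  have key := tendsto_integral_filter_of_dominated_convergence (μ := volume.restrict S)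
    (F := fun m p => ℓ m / (ℓ m + circleDist p.1 p.2) * G p) (f := fun _ => 0)
    (l := Filter.atTop) (fun p => |G p|) ?_ ?_ hG.abs ?_
  · simpa using key
  · refine Filter.Eventually.of_forall fun m => ?_
    refine AEStronglyMeasurable.mul ?_ hG.1
    exact (measurable_const.div
      (measurable_const.add continuous_circleDist.measurable)).aestronglyMeasurable
  · filter_upwards [hℓ0] with m hm
    refine Filter.Eventually.of_forall fun p => ?_
    have hd := circleDist_nonneg p.1 p.2
    rw [norm_mul, Real.norm_eq_abs, Real.norm_eq_abs, abs_of_nonneg (by positivity)]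
    refine mul_le_of_le_one_left (abs_nonneg _) ?_
    rw [div_le_one (by positivity)]
    linarith
  · refine Filter.Eventually.of_forall fun p => ?_
    by_cases h : circleDist p.1 p.2 = 0
    · simp [hG0 p h]
    · have := (hℓ.div (hℓ.add_const (circleDist p.1 p.2)) (by simpa using h)).mul_const (G p)
      simpa using this

section Averages

variable {n : ℕ}

theorem sq_norm_integral_le {α : Type*} [MeasurableSpace α] {μ : Measure α} [IsFiniteMeasure μ]
    {F : α → EuclideanSpace ℝ (Fin n)} (hF : Integrable F μ)
    (hF2 : Integrable (fun x => ‖F x‖ ^ 2) μ) :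
    ‖∫ x, F x ∂μ‖ ^ 2 ≤ μ.real Set.univ * ∫ x, ‖F x‖ ^ 2 ∂μ := by
  set M := μ.real Set.univ with hM
  set I := ∫ x, ‖F x‖ ∂μ with hI
  set Q := ∫ x, ‖F x‖ ^ 2 ∂μ with hQ
  have hle : ‖∫ x, F x ∂μ‖ ≤ I := norm_integral_le_integral_norm F
  have hM0 : 0 ≤ M := measureReal_nonneg
  have hquad : ∀ c : ℝ, 0 ≤ Q - 2 * c * I + c ^ 2 * M := by
    intro c
    have h0 : 0 ≤ ∫ x, (‖F x‖ - c) ^ 2 ∂μ := integral_nonneg fun x => sq_nonneg _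
    have h1 : ∫ x, (‖F x‖ - c) ^ 2 ∂μ = Q - 2 * c * I + c ^ 2 * M := by
      have : ∀ x, (‖F x‖ - c) ^ 2 = ‖F x‖ ^ 2 - 2 * c * ‖F x‖ + c ^ 2 := fun x => by ring
      simp_rw [this]
      have hsub : Integrable (fun x => ‖F x‖ ^ 2 - 2 * c * ‖F x‖) μ :=
        hF2.sub (hF.norm.const_mul _)
      rw [integral_add hsub (integrable_const _),
        integral_sub hF2 (hF.norm.const_mul _), integral_const_mul, integral_const, smul_eq_mul,
        mul_comm (μ.real Set.univ)]
    linarith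
  have hsq : I ^ 2 ≤ M * Q := by
    rcases hM0.eq_or_lt with h | h
    · have hμ : μ = 0 :=
        Measure.measure_univ_eq_zero.1 ((measureReal_eq_zero_iff).1 (hM ▸ h.symm))
      simp [hI, hμ, ← h]
    · have := mul_nonneg h.le (hquad (I / M))
      have h2 : M * (Q - 2 * (I / M) * I + (I / M) ^ 2 * M) = M * Q - I ^ 2 := by
        field_simp
        ring
      linarith
  calc ‖∫ x, F x ∂μ‖ ^ 2 ≤ I ^ 2 := by gcongr
    _ ≤ M * Q := hsq

theorem integral_prod_sub {u : ℝ → EuclideanSpace ℝ (Fin n)} {a b c d : ℝ} (hab : a ≤ b)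
    (hcd : c ≤ d) (hu : LocallyIntegrable u volume) :
    IntegrableOn (fun p : ℝ × ℝ => u p.1 - u p.2) (Set.Ioc a b ×ˢ Set.Ioc c d) volume ∧
    ∫ p in Set.Ioc a b ×ˢ Set.Ioc c d, (u p.1 - u p.2) =
      (d - c) • (∫ t in a..b, u t) - (b - a) • ∫ t in c..d, u t := by
  have h₁ : IntegrableOn u (Set.Ioc a b) volume :=
    (hu.integrableOn_isCompact isCompact_Icc).mono_set Set.Ioc_subset_Icc_self
  have h₂ : IntegrableOn u (Set.Ioc c d) volume :=
    (hu.integrableOn_isCompact isCompact_Icc).mono_set Set.Ioc_subset_Icc_self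
  have hμ : (volume : Measure (ℝ × ℝ)).restrict (Set.Ioc a b ×ˢ Set.Ioc c d) =
      (volume.restrict (Set.Ioc a b)).prod (volume.restrict (Set.Ioc c d)) :=
    (Measure.prod_restrict _ _).symm
  have i₁ := h₁.comp_fst (volume.restrict (Set.Ioc c d))
  have i₂ := h₂.comp_snd (volume.restrict (Set.Ioc a b))
  rw [IntegrableOn, hμ]
  refine ⟨i₁.sub i₂, ?_⟩
  rw [integral_sub i₁ i₂, integral_fun_fst (fun x => u x), integral_fun_snd (fun x => u x),
    intervalIntegral.integral_of_le hab, intervalIntegral.integral_of_le hcd]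
  simp [hab, hcd]

theorem mul_sq_norm_sub_le {e e' : EuclideanSpace ℝ (Fin n)} (he : ‖e‖ = ‖e'‖) (h h' : ℝ) :
    h * h' * ‖e - e'‖ ^ 2 ≤ ‖h' • e - h • e'‖ ^ 2 := by
  rw [norm_sub_sq_real, norm_sub_sq_real, norm_smul, norm_smul, real_inner_smul_left,
    real_inner_smul_right, he, mul_pow, mul_pow, Real.norm_eq_abs, Real.norm_eq_abs, sq_abs, sq_abs]
  nlinarith [mul_nonneg (sq_nonneg (h - h')) (sq_nonneg ‖e'‖)]

theorem sq_norm_integral_sub_integral_le {u : ℝ → EuclideanSpace ℝ (Fin n)} {a b c d : ℝ}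
    (hab : a < b) (hcd : c < d) (hu : LocallyIntegrable u volume)
    (hu2 : IntegrableOn (fun p : ℝ × ℝ => ‖u p.1 - u p.2‖ ^ 2) (Set.Ioc a b ×ˢ Set.Ioc c d) volume)
    (he : ‖∫ t in a..b, u t‖ = ‖∫ t in c..d, u t‖) :
    ‖(∫ t in a..b, u t) - ∫ t in c..d, u t‖ ^ 2 ≤
      ∫ p in Set.Ioc a b ×ˢ Set.Ioc c d, ‖u p.1 - u p.2‖ ^ 2 := by
  obtain ⟨hint, heq⟩ := integral_prod_sub hab.le hcd.le hu
  have hvol : volume.real (Set.Ioc a b ×ˢ Set.Ioc c d : Set (ℝ × ℝ)) = (b - a) * (d - c) := by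
    rw [Measure.volume_eq_prod, measureReal_prod_prod, Real.volume_real_Ioc_of_le hab.le,
      Real.volume_real_Ioc_of_le hcd.le]
  have hfin : IsFiniteMeasure
      ((volume : Measure (ℝ × ℝ)).restrict (Set.Ioc a b ×ˢ Set.Ioc c d)) := by
    rw [Measure.volume_eq_prod, ← Measure.prod_restrict]
    infer_instance
  have h := sq_norm_integral_le hint hu2
  rw [heq, measureReal_restrict_apply_univ, hvol] at h
  exact le_of_mul_le_mul_left ((mul_sq_norm_sub_le he _ _).trans h)
    (mul_pos (sub_pos.2 hab) (sub_pos.2 hcd))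

end Averages

theorem abs_remainder_le {c c' A A' a b ℓ κ M Q : ℝ} (hℓ : 0 < ℓ) (hκ : 0 < κ)
    (hM : ℓ ≤ M * κ) (hc : κ ≤ c) (hc' : κ ≤ c') (hA : κ / 4 ≤ A) (hA' : κ / 4 ≤ A')
    (ha : |a| ≤ 1) (hAA : (A - A') ^ 2 ≤ Q / 4) (hAl : |A - A'| ≤ 2 * ℓ)
    (hab : |a - b| ≤ Q / (2 * ℓ ^ 2)) :
    |1 / 2 * (ℓ * ℓ / (c * c')) * ((1 - A' / A) * a + (1 - A / A') * b)| ≤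
      2 * (1 + M) * Q * ℓ / κ ^ 3 := by
  have hA0 : 0 < A := by linarith
  have hA0' : 0 < A' := by linarith
  have hQ : 0 ≤ Q := by linarith [sq_nonneg (A - A')]
  have hid : (1 - A' / A) * a + (1 - A / A') * b =
      -((A - A') ^ 2 * a / (A * A')) + (A - A') * (a - b) / A' := by
    field_simp
    ring
  have h₁ : |(A - A') ^ 2 * a / (A * A')| ≤ Q / 4 * 1 / (κ / 4 * (κ / 4)) := by
    rw [abs_div, abs_mul, abs_of_nonneg (sq_nonneg (A - A')), abs_of_pos (mul_pos hA0 hA0')]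
    gcongr
  have h₂ : |(A - A') * (a - b) / A'| ≤ 2 * ℓ * (Q / (2 * ℓ ^ 2)) / (κ / 4) := by
    rw [abs_div, abs_mul, abs_of_pos hA0']
    gcongr
  have h₃ : |1 / 2 * (ℓ * ℓ / (c * c'))| ≤ 1 / 2 * (ℓ * ℓ / (κ * κ)) := by
    have : 0 < c := by linarith
    have : 0 < c' := by linarith
    rw [abs_of_nonneg (by positivity)]
    gcongr
  rw [abs_mul, hid]
  calc _ ≤ 1 / 2 * (ℓ * ℓ / (κ * κ)) *
        (Q / 4 * 1 / (κ / 4 * (κ / 4)) + 2 * ℓ * (Q / (2 * ℓ ^ 2)) / (κ / 4)) := by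
        gcongr
        refine (abs_add_le _ _).trans ?_
        rw [abs_neg]
        gcongr
    _ = 2 * Q * ℓ / κ ^ 4 * (ℓ + κ) := by
        field_simp
        ring
    _ ≤ 2 * Q * ℓ / κ ^ 4 * ((1 + M) * κ) := by
        gcongr
        linarith
    _ = _ := by
        field_simp

section Partition

variable {n m : ℕ} {f : ℝ → EuclideanSpace ℝ (Fin n)} {θ : ℤ → ℝ} {ℓ L₁ L₂ : ℝ}

theorem mul_le_sub_of_le_step {s : ℝ} (h : ∀ i, s ≤ θ (i + 1) - θ i) (k : ℕ) (i : ℤ) :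
    k * s ≤ θ (i + k) - θ i := by
  induction k with
  | zero => simp
  | succ k ih =>
    have := h (i + k)
    push_cast
    rw [← add_assoc]
    linarith

theorem sub_lt_one (hmono : StrictMono θ) (hper : ∀ i, θ (i + m) = θ i + 1) {i j : ℤ}
    (hij : j < i + m) : θ j - θ i < 1 := by
  have := hmono hij
  rw [hper] at this
  linarith

theorem edge_length_pos (hL₁ : 0 < L₁)
    (hbl : ∀ a b : ℝ,
      L₁ * circleDist a b ≤ ‖f a - f b‖ ∧ ‖f a - f b‖ ≤ L₂ * circleDist a b)
    (hmono : StrictMono θ) (hper : ∀ i, θ (i + m) = θ i + 1) (hm : 2 ≤ m)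
    (hedge : ∀ i, ‖edge f θ i‖ = ℓ) : 0 < ℓ := by
  have h₀ : 0 < θ (0 + 1) - θ 0 := sub_pos.2 (hmono (by norm_num))
  have h₁ : θ (0 + 1) - θ 0 < 1 := sub_lt_one (m := m) hmono hper (by omega)
  have h := (hbl (θ (0 + 1)) (θ 0)).1
  have he := hedge 0
  rw [edge] at he
  rw [he, circleDist_comm, circleDist_eq_min h₀ h₁] at h
  exact (mul_pos hL₁ (lt_min h₀ (sub_pos.2 h₁))).trans_le h

theorem edge_length_le_mul_step (hL₂ : 0 ≤ L₂)
    (hbl : ∀ a b : ℝ,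
      L₁ * circleDist a b ≤ ‖f a - f b‖ ∧ ‖f a - f b‖ ≤ L₂ * circleDist a b)
    (hmono : StrictMono θ) (hedge : ∀ i, ‖edge f θ i‖ = ℓ) (i : ℤ) :
    ℓ ≤ L₂ * (θ (i + 1) - θ i) := by
  have h := (hbl (θ (i + 1)) (θ i)).2
  have he := hedge i
  rw [edge] at he
  rw [he] at h
  refine h.trans (mul_le_mul_of_nonneg_left ?_ hL₂)
  refine (circleDist_le_abs _ _).trans_eq (abs_of_pos (sub_pos.2 (hmono (lt_add_one i))))

theorem mul_edge_length_le (hL₂ : 0 < L₂)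
    (hbl : ∀ a b : ℝ,
      L₁ * circleDist a b ≤ ‖f a - f b‖ ∧ ‖f a - f b‖ ≤ L₂ * circleDist a b)
    (hmono : StrictMono θ) (hedge : ∀ i, ‖edge f θ i‖ = ℓ) (k : ℕ) (i : ℤ) :
    k * ℓ ≤ L₂ * (θ (i + k) - θ i) := by
  have h := mul_le_sub_of_le_step (θ := θ) (s := ℓ / L₂) (fun i => by
    rw [div_le_iff₀' hL₂]
    exact edge_length_le_mul_step hL₂.le hbl hmono hedge i) k i
  rwa [← mul_div_assoc, div_le_iff₀' hL₂] at h

theorem mul_step_le_edge_length (hL₁ : 0 < L₁) (hL₂ : 0 < L₂)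
    (hbl : ∀ a b : ℝ,
      L₁ * circleDist a b ≤ ‖f a - f b‖ ∧ ‖f a - f b‖ ≤ L₂ * circleDist a b)
    (hmono : StrictMono θ) (hper : ∀ i, θ (i + m) = θ i + 1) (hm : 2 ≤ m)
    (hmL : L₂ < (m - 1) * L₁)
    (hedge : ∀ i, ‖edge f θ i‖ = ℓ) (i : ℤ) :
    L₁ * (θ (i + 1) - θ i) ≤ ℓ := by
  have hℓ := edge_length_pos hL₁ hbl hmono hper hm hedge
  have h₀ : 0 < θ (i + 1) - θ i := sub_pos.2 (hmono (lt_add_one i))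
  have h₁ : θ (i + 1) - θ i < 1 := sub_lt_one (m := m) hmono hper (by omega)
  have h := (hbl (θ (i + 1)) (θ i)).1
  have he := hedge i
  rw [edge] at he
  rw [he, circleDist_comm, circleDist_eq_min h₀ h₁, mul_min_of_nonneg _ _ hL₁.le] at h
  rcases min_le_iff.1 h with h | h
  · exact h
  · have hk := mul_edge_length_le hL₂ hbl hmono hedge (m - 1) (i + 1)
    have hi : i + 1 + ((m - 1 : ℕ) : ℤ) = i + m := by omega
    rw [hi, hper, Nat.cast_sub (by omega), Nat.cast_one] at hk
    have h2 : L₁ * ((m - 1) * ℓ) ≤ L₂ * ℓ := by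
      calc L₁ * ((m - 1) * ℓ) ≤ L₁ * (L₂ * (θ i + 1 - θ (i + 1))) := by gcongr
        _ = L₂ * (L₁ * (1 - (θ (i + 1) - θ i))) := by ring
        _ ≤ L₂ * ℓ := by gcongr
    nlinarith

theorem edge_length_le_mul_circleDist_of_lt (hL₂ : 0 ≤ L₂)
    (hbl : ∀ a b : ℝ,
      L₁ * circleDist a b ≤ ‖f a - f b‖ ∧ ‖f a - f b‖ ≤ L₂ * circleDist a b)
    (hmono : StrictMono θ) (hper : ∀ i, θ (i + m) = θ i + 1)
    (hedge : ∀ i, ‖edge f θ i‖ = ℓ) {i j : ℤ} (hij : i < j) (hji : j < i + m) :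
    ℓ ≤ L₂ * circleDist (θ i) (θ j) := by
  rw [circleDist_eq_min (sub_pos.2 (hmono hij)) (sub_lt_one hmono hper hji),
    mul_min_of_nonneg _ _ hL₂]
  refine le_min ?_ ?_
  · refine (edge_length_le_mul_step hL₂ hbl hmono hedge i).trans ?_
    have := hmono.monotone (show i + 1 ≤ j by omega)
    gcongr
  · refine (edge_length_le_mul_step hL₂ hbl hmono hedge j).trans ?_
    have := hmono.monotone (show j + 1 ≤ i + m by omega)
    rw [hper] at this
    exact mul_le_mul_of_nonneg_left (by linarith) hL₂

theorem edge_length_le_mul_circleDist (hL₂ : 0 ≤ L₂)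
    (hbl : ∀ a b : ℝ,
      L₁ * circleDist a b ≤ ‖f a - f b‖ ∧ ‖f a - f b‖ ≤ L₂ * circleDist a b)
    (hmono : StrictMono θ) (hper : ∀ i, θ (i + m) = θ i + 1)
    (hedge : ∀ i, ‖edge f θ i‖ = ℓ) {i j : ℤ} (hij : i ≠ j) (hlt : |i - j| < m) :
    ℓ ≤ L₂ * circleDist (θ i) (θ j) := by
  rw [abs_lt] at hlt
  rcases hij.lt_or_gt with h | h
  · exact edge_length_le_mul_circleDist_of_lt hL₂ hbl hmono hper hedge h (by omega)
  · rw [circleDist_comm]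
    exact edge_length_le_mul_circleDist_of_lt hL₂ hbl hmono hper hedge h (by omega)

/-- The cell `(θ_p, θ_{p+1}] × (θ_q, θ_{q+1}]` of the partition of the torus. -/
def cell (θ : ℤ → ℝ) (p q : ℤ) : Set (ℝ × ℝ) :=
  Set.Ioc (θ p) (θ (p + 1)) ×ˢ Set.Ioc (θ q) (θ (q + 1))

theorem measurableSet_cell (p q : ℤ) : MeasurableSet (cell θ p q) :=
  measurableSet_Ioc.prod measurableSet_Ioc

theorem cell_subset (hmono : Monotone θ) (hper : ∀ i, θ (i + m) = θ i + 1) (a b : ℤ) {p q : ℤ}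
    (hp : a ≤ p) (hp' : p < a + m) (hq : b ≤ q) (hq' : q < b + m) :
    cell θ p q ⊆ Set.Ioc (θ a) (θ a + 1) ×ˢ Set.Ioc (θ b) (θ b + 1) := by
  rw [← hper, ← hper]
  exact Set.prod_mono (Set.Ioc_subset_Ioc (hmono hp) (hmono (by omega)))
    (Set.Ioc_subset_Ioc (hmono hq) (hmono (by omega)))

theorem pairwise_disjoint_cell (hmono : Monotone θ) :
    Pairwise fun x y : ℤ × ℤ => Disjoint (cell θ x.1 x.2) (cell θ y.1 y.2) := by
  have hd : Pairwise fun p q : ℤ =>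
      Disjoint (Set.Ioc (θ p) (θ (p + 1))) (Set.Ioc (θ q) (θ (q + 1))) :=
    hmono.pairwise_disjoint_on_Ioc_succ
  rintro ⟨p, q⟩ ⟨p', q'⟩ h
  refine Set.disjoint_prod.2 ?_
  by_cases hp : p = p'
  · exact Or.inr (hd fun hq => h (Prod.ext hp hq))
  · exact Or.inl (hd hp)

theorem sum_setIntegral_cell_le (hmono : Monotone θ) (hper : ∀ i, θ (i + m) = θ i + 1)
    {H : ℝ × ℝ → ℝ} (h₁ : ∀ x y, H (x + 1, y) = H (x, y)) (h₂ : ∀ x y, H (x, y + 1) = H (x, y))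
    (h0 : ∀ p, 0 ≤ H p) (hint : IntegrableOn H (Set.Ioc 0 (0 + 1) ×ˢ Set.Ioc 0 (0 + 1)) volume)
    (a b : ℤ) :
    ∑ i ∈ Finset.Icc (1 : ℤ) m, ∑ j ∈ Finset.Icc (1 : ℤ) m, ∫ p in cell θ (i + a) (j + b), H p ≤
      ∫ p in Set.Ioc 0 (0 + 1) ×ˢ Set.Ioc 0 (0 + 1), H p := by
  rw [← Finset.sum_product', ← setIntegral_Ioc_prod_eq h₁ h₂ (θ (1 + a)) (θ (1 + b)) 0 0]
  have hint' := (integrableOn_Ioc_prod_iff h₁ h₂ 0 0 (θ (1 + a)) (θ (1 + b))).1 hint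
  have hsub : ∀ x ∈ Finset.Icc (1 : ℤ) m ×ˢ Finset.Icc (1 : ℤ) m,
      cell θ (x.1 + a) (x.2 + b) ⊆
        Set.Ioc (θ (1 + a)) (θ (1 + a) + 1) ×ˢ Set.Ioc (θ (1 + b)) (θ (1 + b) + 1) := by
    intro x hx
    simp only [Finset.mem_product, Finset.mem_Icc] at hx
    exact cell_subset hmono hper _ _ (by omega) (by omega) (by omega) (by omega)
  rw [← integral_biUnion_finset _ (fun x _ => measurableSet_cell _ _) ?_
    (fun x hx => hint'.mono_set (hsub x hx))]
  · exact setIntegral_mono_set hint' (Filter.Eventually.of_forall h0)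
      (Set.iUnion₂_subset hsub).eventuallyLE
  · intro x _ y _ hxy
    refine pairwise_disjoint_cell hmono (i := (x.1 + a, x.2 + b)) (j := (y.1 + a, y.2 + b)) ?_
    simpa [Prod.ext_iff] using hxy

end Partition

section Summand

variable {n : ℕ}

/-- The integrand of the squared `H^{1/2}`-seminorm. -/
def gagliardo (u : ℝ → EuclideanSpace ℝ (Fin n)) (p : ℝ × ℝ) : ℝ :=
  ‖u p.1 - u p.2‖ ^ 2 / circleDist p.1 p.2 ^ 2

/-- The seminorm integrand damped away from the diagonal at scale `ℓ`. -/
def damped (u : ℝ → EuclideanSpace ℝ (Fin n)) (ℓ : ℝ) (p : ℝ × ℝ) : ℝ :=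
  ℓ / (ℓ + circleDist p.1 p.2) * gagliardo u p

variable {u : ℝ → EuclideanSpace ℝ (Fin n)} {ℓ : ℝ}

theorem gagliardo_nonneg (p : ℝ × ℝ) : 0 ≤ gagliardo u p := by
  unfold gagliardo
  positivity

theorem gagliardo_eq_zero {p : ℝ × ℝ} (h : circleDist p.1 p.2 = 0) : gagliardo u p = 0 := by
  simp [gagliardo, h]

theorem damped_nonneg (hℓ : 0 ≤ ℓ) (p : ℝ × ℝ) : 0 ≤ damped u ℓ p :=
  mul_nonneg (div_nonneg hℓ (add_nonneg hℓ (circleDist_nonneg _ _))) (gagliardo_nonneg p)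

theorem gagliardo_add_one_left (hu : ∀ x, u (x + 1) = u x) (x y : ℝ) :
    gagliardo u (x + 1, y) = gagliardo u (x, y) := by
  simp only [gagliardo, hu, circleDist_add_one_left]

theorem gagliardo_add_one_right (hu : ∀ x, u (x + 1) = u x) (x y : ℝ) :
    gagliardo u (x, y + 1) = gagliardo u (x, y) := by
  simp only [gagliardo, hu, circleDist_add_one_right]

theorem damped_add_one_left (hu : ∀ x, u (x + 1) = u x) (x y : ℝ) :
    damped u ℓ (x + 1, y) = damped u ℓ (x, y) := by
  simp only [damped, gagliardo_add_one_left hu, circleDist_add_one_left]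

theorem damped_add_one_right (hu : ∀ x, u (x + 1) = u x) (x y : ℝ) :
    damped u ℓ (x, y + 1) = damped u ℓ (x, y) := by
  simp only [damped, gagliardo_add_one_right hu, circleDist_add_one_right]

theorem sq_norm_sub_eq_mul_gagliardo (hu : ∀ x, u (x + 1) = u x) (p : ℝ × ℝ) :
    ‖u p.1 - u p.2‖ ^ 2 = circleDist p.1 p.2 ^ 2 * gagliardo u p := by
  by_cases h : circleDist p.1 p.2 = 0
  · obtain ⟨k, hk⟩ := exists_int_eq_add_of_circleDist_eq_zero h
    simp [hk, apply_add_int_of_periodic hu, gagliardo]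
  · rw [gagliardo, mul_div_cancel₀ _ (pow_ne_zero 2 h)]

theorem circleDist_le_one (a b : ℝ) : circleDist a b ≤ 1 :=
  (min_le_left _ _).trans (Int.fract_lt_one _).le

theorem integrableOn_damped (hℓ : 0 < ℓ) {S : Set (ℝ × ℝ)} (hG : IntegrableOn (gagliardo u) S) :
    IntegrableOn (damped u ℓ) S := by
  refine Integrable.bdd_mul (c := 1) hG ?_ (Filter.Eventually.of_forall fun p => ?_)
  · exact (measurable_const.div
      (measurable_const.add continuous_circleDist.measurable)).aestronglyMeasurable
  · have hd := circleDist_nonneg p.1 p.2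
    rw [Real.norm_eq_abs, abs_of_nonneg (by positivity), div_le_one (by positivity)]
    linarith

theorem integrableOn_sq_norm_sub (hu : ∀ x, u (x + 1) = u x) {S : Set (ℝ × ℝ)}
    (hG : IntegrableOn (gagliardo u) S) : IntegrableOn (fun p => ‖u p.1 - u p.2‖ ^ 2) S := by
  simp_rw [sq_norm_sub_eq_mul_gagliardo hu]
  refine Integrable.bdd_mul (c := 1) hG ?_ (Filter.Eventually.of_forall fun p => ?_)
  · exact (continuous_circleDist.pow 2).aestronglyMeasurable
  · have hd := circleDist_nonneg p.1 p.2
    rw [Real.norm_eq_abs, abs_of_nonneg (by positivity)]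
    exact pow_le_one₀ hd (circleDist_le_one _ _)

variable {f : ℝ → EuclideanSpace ℝ (Fin n)} {θ : ℤ → ℝ}

theorem sq_norm_edge_sub_le (hu : ∀ x, u (x + 1) = u x) (hloc : LocallyIntegrable u volume)
    (hFTC : ∀ a b : ℝ, f b - f a = ∫ t in a..b, u t) (hmono : StrictMono θ) (hℓ : 0 < ℓ)
    (hedge : ∀ i, ‖edge f θ i‖ = ℓ) {p q : ℤ} (hG : IntegrableOn (gagliardo u) (cell θ p q))
    {R : ℝ} (hR : ∀ z ∈ cell θ p q, ℓ + circleDist z.1 z.2 ≤ R) :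
    ‖edge f θ p - edge f θ q‖ ^ 2 ≤ R ^ 3 / ℓ * ∫ z in cell θ p q, damped u ℓ z := by
  have he : ‖∫ t in θ p..θ (p + 1), u t‖ = ‖∫ t in θ q..θ (q + 1), u t‖ := by
    rw [← hFTC, ← hFTC]
    exact (hedge p).trans (hedge q).symm
  have h := sq_norm_integral_sub_integral_le (hmono (lt_add_one p)) (hmono (lt_add_one q)) hloc
    (integrableOn_sq_norm_sub hu hG) he
  rw [← hFTC, ← hFTC] at h
  refine h.trans ?_
  rw [← integral_const_mul]
  refine setIntegral_mono_on (integrableOn_sq_norm_sub hu hG)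
    ((integrableOn_damped hℓ hG).const_mul _) (measurableSet_cell p q) fun z hz => ?_
  have hd := circleDist_nonneg z.1 z.2
  have hz' := hR z hz
  rw [sq_norm_sub_eq_mul_gagliardo hu, damped, ← mul_assoc]
  refine mul_le_mul_of_nonneg_right ?_ (gagliardo_nonneg z)
  generalize circleDist z.1 z.2 = d at *
  calc d ^ 2 ≤ (ℓ + d) ^ 2 := by gcongr; linarith
    _ = (ℓ + d) ^ 3 / ℓ * (ℓ / (ℓ + d)) := by field_simp
    _ ≤ R ^ 3 / ℓ * (ℓ / (ℓ + d)) := by gcongr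

theorem abs_chn_sub_chn_le (p q : ℤ) :
    |chn f θ p q - chn f θ (p + 1) (q + 1)| ≤ ‖edge f θ p - edge f θ q‖ := by
  refine (abs_norm_sub_norm_le _ _).trans_eq (congrArg norm ?_)
  simp only [chord, edge]
  abel

/-- The sum of a doubly indexed quantity over the four corners of a cell. -/
def cornerSum (w : ℤ → ℤ → ℝ) (i j : ℤ) : ℝ :=
  w i j + w (i + 1) j + w i (j + 1) + w (i + 1) (j + 1)

theorem abs_aOpIJ_sub_le (i j : ℤ) :
    |aOpIJ (chn f θ) i j - aOpIJ (chn f θ) (i + 1) (j + 1)| ≤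
      cornerSum (fun p q => ‖edge f θ p - edge f θ q‖) i j / 4 := by
  have h₁ := abs_le.1 (abs_chn_sub_chn_le (f := f) (θ := θ) i j)
  have h₂ := abs_le.1 (abs_chn_sub_chn_le (f := f) (θ := θ) (i + 1) j)
  have h₃ := abs_le.1 (abs_chn_sub_chn_le (f := f) (θ := θ) i (j + 1))
  have h₄ := abs_le.1 (abs_chn_sub_chn_le (f := f) (θ := θ) (i + 1) (j + 1))
  simp only [aOpIJ, cornerSum]
  rw [abs_le]
  constructor <;> linarith

theorem inner_uedge (hℓ : 0 < ℓ) (hedge : ∀ i, ‖edge f θ i‖ = ℓ) (i j : ℤ) :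
    ⟪uedge f θ i, uedge f θ j⟫ = 1 - ‖edge f θ i - edge f θ j‖ ^ 2 / (2 * ℓ ^ 2) := by
  rw [norm_sub_sq_real, uedge, uedge, real_inner_smul_left, real_inner_smul_right, hedge, hedge]
  field_simp
  ring

theorem abs_inner_uedge_le (i j : ℤ) : |⟪uedge f θ i, uedge f θ j⟫| ≤ 1 := by
  have h : ∀ i, ‖uedge f θ i‖ ≤ 1 := fun i => by
    rw [uedge, norm_smul, norm_inv, norm_norm]
    exact inv_mul_le_one
  exact (abs_real_inner_le_norm _ _).trans (mul_le_one₀ (h i) (norm_nonneg _) (h j))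

theorem quarter_le_aOpIJ {κ : ℝ} {i j : ℤ} (h : κ ≤ chn f θ i j) :
    κ / 4 ≤ aOpIJ (chn f θ) i j := by
  have h0 : ∀ p q, 0 ≤ chn f θ p q := fun p q => norm_nonneg _
  have := h0 (i + 1) j
  have := h0 i (j + 1)
  have := h0 (i + 1) (j + 1)
  simp only [aOpIJ]
  linarith

theorem abs_summand_le (hℓ : 0 < ℓ) (hedge : ∀ i, ‖edge f θ i‖ = ℓ) {κ M N : ℝ} (hκ : 0 < κ)
    (hM : ℓ ≤ M * κ) {i j : ℤ} (hc : κ ≤ chn f θ i j) (hc' : κ ≤ chn f θ (i + 1) (j + 1))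
    {V : ℤ → ℤ → ℝ}
    (hV : ∀ p q, (p = i ∨ p = i + 1) → (q = j ∨ q = j + 1) →
      ‖edge f θ p - edge f θ q‖ ^ 2 ≤ (N * κ) ^ 3 / ℓ * V p q) :
    |(1 / 2) *
        ((‖edge f θ i‖ * ‖edge f θ j‖) / (chn f θ i j * chn f θ (i + 1) (j + 1))) *
        ((1 - aOpIJ (chn f θ) (i + 1) (j + 1) / aOpIJ (chn f θ) i j) *
            ⟪uedge f θ i, uedge f θ j⟫ +
          (1 - aOpIJ (chn f θ) i j / aOpIJ (chn f θ) (i + 1) (j + 1)) *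
            ⟪uedge f θ (i + 1), uedge f θ (j + 1)⟫)| ≤
      2 * (1 + M) * N ^ 3 * cornerSum V i j := by
  have hM0 : 0 ≤ M := by
    by_contra! h
    nlinarith
  have hA := abs_aOpIJ_sub_le (f := f) (θ := θ) i j
  have hQ : cornerSum (fun p q => ‖edge f θ p - edge f θ q‖ ^ 2) i j ≤
      (N * κ) ^ 3 / ℓ * cornerSum V i j := by
    simp only [cornerSum, mul_add]
    gcongr <;> refine hV _ _ ?_ ?_ <;> simp
  have hδ : ∀ p q, ‖edge f θ p - edge f θ q‖ ≤ 2 * ℓ := fun p q =>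
    (norm_sub_le _ _).trans_eq (by rw [hedge, hedge]; ring)
  set Q := cornerSum (fun p q => ‖edge f θ p - edge f θ q‖ ^ 2) i j with hQdef
  have hAA : (aOpIJ (chn f θ) i j - aOpIJ (chn f θ) (i + 1) (j + 1)) ^ 2 ≤ Q / 4 := by
    rw [← sq_abs]
    refine (pow_le_pow_left₀ (abs_nonneg _) hA 2).trans ?_
    rw [hQdef]
    simp only [cornerSum]
    generalize ‖edge f θ i - edge f θ j‖ = x
    generalize ‖edge f θ (i + 1) - edge f θ j‖ = y
    generalize ‖edge f θ i - edge f θ (j + 1)‖ = z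
    generalize ‖edge f θ (i + 1) - edge f θ (j + 1)‖ = w
    nlinarith [sq_nonneg (x - y), sq_nonneg (x - z), sq_nonneg (x - w), sq_nonneg (y - z),
      sq_nonneg (y - w), sq_nonneg (z - w)]
  have hAl : |aOpIJ (chn f θ) i j - aOpIJ (chn f θ) (i + 1) (j + 1)| ≤ 2 * ℓ := by
    refine hA.trans ?_
    simp only [cornerSum]
    linarith [hδ i j, hδ (i + 1) j, hδ i (j + 1), hδ (i + 1) (j + 1)]
  have hab : |⟪uedge f θ i, uedge f θ j⟫ - ⟪uedge f θ (i + 1), uedge f θ (j + 1)⟫| ≤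
      Q / (2 * ℓ ^ 2) := by
    rw [inner_uedge hℓ hedge, inner_uedge hℓ hedge, sub_sub_sub_cancel_left, ← sub_div, abs_div,
      abs_of_pos (show 0 < 2 * ℓ ^ 2 by positivity)]
    gcongr
    rw [hQdef, abs_le]
    simp only [cornerSum]
    constructor <;>
    linarith [sq_nonneg ‖edge f θ i - edge f θ j‖, sq_nonneg ‖edge f θ (i + 1) - edge f θ j‖,
      sq_nonneg ‖edge f θ i - edge f θ (j + 1)‖,
      sq_nonneg ‖edge f θ (i + 1) - edge f θ (j + 1)‖]
  rw [hedge, hedge]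
  refine (abs_remainder_le hℓ hκ hM hc hc' (quarter_le_aOpIJ hc) (quarter_le_aOpIJ hc')
    (abs_inner_uedge_le i j) hAA hAl hab).trans ?_
  calc 2 * (1 + M) * Q * ℓ / κ ^ 3
      ≤ 2 * (1 + M) * ((N * κ) ^ 3 / ℓ * cornerSum V i j) * ℓ / κ ^ 3 := by gcongr
    _ = _ := by field_simp

end Summand

theorem chn_ge_and_circleDist_le {n m : ℕ} {f : ℝ → EuclideanSpace ℝ (Fin n)} {θ : ℤ → ℝ}
    {ℓ L₁ L₂ : ℝ} (hL₁ : 0 < L₁) (hL₂ : 0 < L₂)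
    (hbl : ∀ a b : ℝ,
      L₁ * circleDist a b ≤ ‖f a - f b‖ ∧ ‖f a - f b‖ ≤ L₂ * circleDist a b)
    (hmono : StrictMono θ) (hper : ∀ i, θ (i + m) = θ i + 1) (hm : 2 ≤ m)
    (hmL : L₂ < (m - 1) * L₁) (hedge : ∀ i, ‖edge f θ i‖ = ℓ) :
    ∃ κ : ℤ → ℤ → ℝ, ∀ i j : ℤ, i ≠ j → |i - j| < m →
      0 < κ i j ∧ ℓ ≤ (L₂ * (1 + 2 * L₂ / L₁) / L₁) * κ i j ∧
      κ i j ≤ chn f θ i j ∧ κ i j ≤ chn f θ (i + 1) (j + 1) ∧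
      ∀ p q, (p = i ∨ p = i + 1) → (q = j ∨ q = j + 1) → ∀ z ∈ cell θ p q,
        ℓ + circleDist z.1 z.2 ≤
          (((1 + 4 / L₁) * L₂ + 1) * (1 + 2 * L₂ / L₁) / L₁) * κ i j := by
  have hℓ := edge_length_pos hL₁ hbl hmono hper hm hedge
  have hstep : ∀ i, θ (i + 1) - θ i ≤ ℓ / L₁ := fun i => by
    rw [le_div_iff₀' hL₁]
    exact mul_step_le_edge_length hL₁ hL₂ hbl hmono hper hm hmL hedge i
  have hnear : ∀ i x, θ i ≤ x → x ≤ θ (i + 1 + 1) → circleDist x (θ i) ≤ 2 * (ℓ / L₁) := by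
    intro i x h h'
    refine (circleDist_le_abs _ _).trans ?_
    rw [abs_of_nonneg (sub_nonneg.2 h)]
    linarith [hstep i, hstep (i + 1)]
  have hnear₁ : ∀ i, circleDist (θ (i + 1)) (θ i) ≤ ℓ / L₁ := by
    intro i
    refine (circleDist_le_abs _ _).trans ?_
    rw [abs_of_pos (sub_pos.2 (hmono (lt_add_one i)))]
    exact hstep i
  refine ⟨fun i j => L₁ * circleDist (θ i) (θ j) / (1 + 2 * L₂ / L₁), fun i j hij hlt => ?_⟩
  have hd := edge_length_le_mul_circleDist hL₂.le hbl hmono hper hedge hij hlt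
  have hd' := edge_length_le_mul_circleDist hL₂.le hbl hmono hper hedge
    (show i + 1 ≠ j + 1 by omega) (show |i + 1 - (j + 1)| < m by rwa [add_sub_add_right_eq_sub])
  have hB : 1 ≤ 1 + 2 * L₂ / L₁ := by
    have : 0 ≤ 2 * L₂ / L₁ := by positivity
    linarith
  have hBd : circleDist (θ i) (θ j) ≤
      (1 + 2 * L₂ / L₁) * circleDist (θ (i + 1)) (θ (j + 1)) := by
    have h₁ := circleDist_triangle (θ i) (θ (i + 1)) (θ j)
    have h₂ := circleDist_triangle (θ (i + 1)) (θ (j + 1)) (θ j)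
    have h₃ := hnear₁ i
    rw [circleDist_comm] at h₃
    have h₄ := hnear₁ j
    have h₅ : 2 * (ℓ / L₁) ≤ 2 * L₂ / L₁ * circleDist (θ (i + 1)) (θ (j + 1)) := by
      calc 2 * (ℓ / L₁) ≤ 2 * (L₂ * circleDist (θ (i + 1)) (θ (j + 1)) / L₁) := by gcongr
        _ = _ := by ring
    linarith
  have hd0 : 0 < circleDist (θ i) (θ j) := pos_of_mul_pos_right (hℓ.trans_le hd) hL₂.le
  have hchn : ∀ p q, L₁ * circleDist (θ p) (θ q) ≤ chn f θ p q := fun p q => by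
    rw [circleDist_comm]
    exact (hbl _ _).1
  refine ⟨by positivity, ?_, ?_, ?_, ?_⟩
  · refine hd.trans_eq ?_
    field_simp
  · exact (div_le_self (by positivity) hB).trans (hchn i j)
  · refine le_trans ?_ (hchn (i + 1) (j + 1))
    rw [div_le_iff₀ (by positivity), mul_assoc, mul_comm (circleDist _ _)]
    gcongr
  · rintro p q hp hq ⟨x, y⟩ ⟨⟨hx, hx'⟩, hy, hy'⟩
    dsimp only at hx hx' hy hy' ⊢
    have hle : ∀ {a b : ℤ}, a ≤ b → θ a ≤ θ b := fun h => hmono.monotone h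
    have h₁ := hnear i x ((hle (by omega)).trans hx.le) (hx'.trans (hle (by omega)))
    have h₂ := hnear j y ((hle (by omega)).trans hy.le) (hy'.trans (hle (by omega)))
    have h₃ := circleDist_triangle x (θ i) y
    have h₄ := circleDist_triangle (θ i) (θ j) y
    rw [circleDist_comm (θ j)] at h₄
    calc ℓ + circleDist x y ≤ (1 + 4 / L₁) * ℓ + circleDist (θ i) (θ j) := by
          have : (1 + 4 / L₁) * ℓ = ℓ + 2 * (ℓ / L₁) + 2 * (ℓ / L₁) := by ring
          linarith
      _ ≤ (1 + 4 / L₁) * (L₂ * circleDist (θ i) (θ j)) + circleDist (θ i) (θ j) := by gcongr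
      _ = _ := by
          field_simp

theorem abs_discSum_le {m : ℕ} {F V : ℤ → ℤ → ℝ} {C T : ℝ} (hC : 0 ≤ C)
    (hV : ∀ p q, 0 ≤ V p q)
    (hF : ∀ i ∈ Finset.Icc (1 : ℤ) m, ∀ j ∈ Finset.Icc (1 : ℤ) m, i ≠ j →
      |F i j| ≤ C * cornerSum V i j)
    (hT : ∀ a b : ℤ,
      ∑ i ∈ Finset.Icc (1 : ℤ) m, ∑ j ∈ Finset.Icc (1 : ℤ) m, V (i + a) (j + b) ≤ T) :
    |discSum m F| ≤ C * (4 * T) := by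
  have hsum : ∑ i ∈ Finset.Icc (1 : ℤ) m, ∑ j ∈ Finset.Icc (1 : ℤ) m, cornerSum V i j ≤ 4 * T := by
    simp only [cornerSum, Finset.sum_add_distrib]
    have h₁ := hT 0 0
    have h₂ := hT 1 0
    have h₃ := hT 0 1
    have h₄ := hT 1 1
    simp only [add_zero] at h₁ h₂ h₃
    linarith
  calc |discSum m F| ≤
        ∑ i ∈ Finset.Icc (1 : ℤ) m, ∑ j ∈ Finset.Icc (1 : ℤ) m, C * cornerSum V i j := by
        refine (Finset.abs_sum_le_sum_abs _ _).trans (Finset.sum_le_sum fun i hi => ?_)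
        refine (Finset.abs_sum_le_sum_abs _ _).trans (Finset.sum_le_sum fun j hj => ?_)
        split_ifs with h
        · have h0 : 0 ≤ cornerSum V i j :=
            add_nonneg (add_nonneg (add_nonneg (hV _ _) (hV _ _)) (hV _ _)) (hV _ _)
          rw [abs_zero]
          positivity
        · exact hF i hi j hj h
    _ = C * ∑ i ∈ Finset.Icc (1 : ℤ) m, ∑ j ∈ Finset.Icc (1 : ℤ) m, cornerSum V i j := by
        simp only [Finset.mul_sum]
    _ ≤ C * (4 * T) := by gcongr

/-- The remainder term `I₁₂` of the discrete energy density sums to zero in the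
limit `m → ∞`. -/
theorem remainder_I12_tendsto_zero (n : ℕ)
    (f fd : ℝ → EuclideanSpace ℝ (Fin n))
    (hf_per : ∀ x : ℝ, f (x + 1) = f x)
    (hfd_per : ∀ x : ℝ, fd (x + 1) = fd x)
    (hfd_loc : LocallyIntegrable fd volume)
    (hFTC : ∀ a b : ℝ, f b - f a = ∫ t in a..b, fd t)
    (hH12 : IntegrableOn
      (fun p : ℝ × ℝ => ‖fd p.1 - fd p.2‖ ^ 2 / circleDist p.1 p.2 ^ 2)
      (Set.Ico (0 : ℝ) 1 ×ˢ Set.Ico (0 : ℝ) 1) volume)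
    (hT12 : IntegrableOn
      (fun p : ℝ × ℝ =>
        ‖(‖fd p.1‖⁻¹ • fd p.1) - (‖fd p.2‖⁻¹ • fd p.2)‖ ^ 2 / circleDist p.1 p.2 ^ 2)
      (Set.Ico (0 : ℝ) 1 ×ˢ Set.Ico (0 : ℝ) 1) volume)
    (L₁ L₂ : ℝ) (hL₁ : 0 < L₁) (hL₁₂ : L₁ ≤ L₂)
    (hbl : ∀ a b : ℝ,
      L₁ * circleDist a b ≤ ‖f a - f b‖ ∧ ‖f a - f b‖ ≤ L₂ * circleDist a b)
    (L : ℝ) (hL : L = ∫ t in (0:ℝ)..1, ‖fd t‖)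
    (θ : ℕ → ℤ → ℝ)
    (hmono : ∀ m : ℕ, 1 ≤ m → StrictMono (θ m))
    (hθper : ∀ m : ℕ, 1 ≤ m → ∀ i : ℤ, θ m (i + m) = θ m i + 1)
    (hθ0 : ∀ m : ℕ, 1 ≤ m → 0 ≤ θ m 1)
    (hθ1 : ∀ m : ℕ, 1 ≤ m → θ m (m : ℤ) < 1)
    (Lm : ℕ → ℝ)
    (hLm : ∀ m : ℕ, Lm m = ∑ i ∈ Finset.Icc (1 : ℤ) (m : ℤ), ‖edge f (θ m) i‖)
    (heq : ∀ m : ℕ, 1 ≤ m → ∀ i : ℤ, ‖edge f (θ m) i‖ = Lm m / m)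
    (hK : Filter.Tendsto (fun ε : ℝ => ε⁻¹ * Kmod fd ε ^ 2)
      (nhdsWithin 0 (Set.Ioi 0)) (nhds 0))
 :
    Filter.Tendsto
      (fun m : ℕ => discSum m (fun i j =>
        (1 / 2) *
          ((‖edge f (θ m) i‖ * ‖edge f (θ m) j‖) /
            (chn f (θ m) i j * chn f (θ m) (i + 1) (j + 1))) *
          ((1 - aOpIJ (chn f (θ m)) (i + 1) (j + 1) / aOpIJ (chn f (θ m)) i j) *
              ⟪uedge f (θ m) i, uedge f (θ m) j⟫ +
            (1 - aOpIJ (chn f (θ m)) i j / aOpIJ (chn f (θ m)) (i + 1) (j + 1)) *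
              ⟪uedge f (θ m) (i + 1), uedge f (θ m) (j + 1)⟫)))
      Filter.atTop (nhds 0) := by
  have hL₂ : 0 < L₂ := hL₁.trans_le hL₁₂
  have hG : IntegrableOn (gagliardo fd) (Set.Ioc 0 (0 + 1) ×ˢ Set.Ioc 0 (0 + 1)) volume := by
    rw [zero_add]
    exact hH12.congr_set_ae (Ico_prod_ae_eq_Ioc_prod 0 1 0 1).symm
  have hlarge : ∀ᶠ m : ℕ in Filter.atTop, 2 ≤ m ∧ L₂ < (m - 1) * L₁ := by
    refine (Filter.eventually_ge_atTop 2).and ?_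
    filter_upwards [tendsto_natCast_atTop_atTop.eventually_gt_atTop (L₂ / L₁ + 1)] with m hm
    rw [← div_lt_iff₀ hL₁]
    linarith
  have hpos : ∀ᶠ m : ℕ in Filter.atTop, 0 < Lm m / m := by
    filter_upwards [hlarge] with m hm
    exact edge_length_pos hL₁ hbl (hmono m (by omega)) (hθper m (by omega)) hm.1 (heq m (by omega))
  have hℓ : Filter.Tendsto (fun m : ℕ => Lm m / m) Filter.atTop (nhds 0) := by
    refine squeeze_zero' (hpos.mono fun m hm => hm.le) ?_ (tendsto_const_div_atTop_nhds_zero_nat L₂)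
    filter_upwards [Filter.eventually_ge_atTop 1] with m hm
    have h := mul_edge_length_le hL₂ hbl (hmono m hm) (heq m hm) m 0
    rw [hθper m hm, add_sub_cancel_left, mul_one] at h
    rwa [le_div_iff₀' (by exact_mod_cast hm)]
  have hlim := tendsto_integral_weight_mul hG (fun _ h => gagliardo_eq_zero h) hpos hℓ
  set M := L₂ * (1 + 2 * L₂ / L₁) / L₁ with hM
  set N := ((1 + 4 / L₁) * L₂ + 1) * (1 + 2 * L₂ / L₁) / L₁ with hN
  have hM0 : 0 ≤ M := by positivity
  have hN0 : 0 ≤ N := by positivity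
  have hbound := (hlim.const_mul 4).const_mul (2 * (1 + M) * N ^ 3)
  rw [mul_zero, mul_zero] at hbound
  refine squeeze_zero_norm' ?_ hbound
  filter_upwards [hlarge, hpos] with m hm hℓm
  have hm₁ : 1 ≤ m := by omega
  have h₁ : ∀ x y, damped fd (Lm m / m) (x + 1, y) = damped fd (Lm m / m) (x, y) :=
    damped_add_one_left hfd_per
  have h₂ : ∀ x y, damped fd (Lm m / m) (x, y + 1) = damped fd (Lm m / m) (x, y) :=
    damped_add_one_right hfd_per
  obtain ⟨κ, hκ⟩ := chn_ge_and_circleDist_le hL₁ hL₂ hbl (hmono m hm₁) (hθper m hm₁) hm.1 hm.2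
    (heq m hm₁)
  refine abs_discSum_le (V := fun p q => ∫ z in cell (θ m) p q, damped fd (Lm m / m) z)
    (by positivity) (fun p q => integral_nonneg fun z => damped_nonneg hℓm.le z) ?_
    (sum_setIntegral_cell_le (hmono m hm₁).monotone (hθper m hm₁) h₁ h₂
      (damped_nonneg hℓm.le) (integrableOn_damped hℓm hG))
  intro i hi j hj hij
  rw [Finset.mem_Icc] at hi hj
  obtain ⟨hκ0, hκM, hc, hc', hR⟩ := hκ i j hij (by rw [abs_lt]; omega)
  refine abs_summand_le hℓm (heq m hm₁) hκ0 hκM hc hc' fun p q hp hq => ?_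
  have hGcell : IntegrableOn (gagliardo fd) (cell (θ m) p q) volume :=
    ((integrableOn_Ioc_prod_iff (gagliardo_add_one_left hfd_per) (gagliardo_add_one_right hfd_per)
      0 0 (θ m p) (θ m q)).1 hG).mono_set
      (cell_subset (hmono m hm₁).monotone (hθper m hm₁) p q le_rfl (by omega) le_rfl (by omega))
  exact sq_norm_edge_sub_le hfd_per hfd_loc hFTC (hmono m hm₁) hℓm (heq m hm₁) hGcell
    (hR p q hp hq)

end
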